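/- Let Y be a (complex) strictly convex Banach space. Then BS(c₀;Y) = {0}, i.e., the zero operator is the only operator from c₀ to Y with the Bhatia–Šemrl property. -/

import Mathlib

noncomputable section

/-- `x` is Birkhoff--James orthogonal to `y`: `‖x‖ ≤ ‖x + a • y‖` for every scalar `a`. -/
def BJOrth (𝕂 : Type*) [RCLike 𝕂] {E : Type*} [NormedAddCommGroup E] [NormedSpace 𝕂 E]
    (x y : E) : Prop :=
  ∀ a : 𝕂, ‖x‖ ≤ ‖x + a • y‖

/-- The Bhatia--Šemrl property for bounded linear operators: whenever `T ⊥_B S` there is a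
norm attaining point `x` of `T` with `T x ⊥_B S x`. -/
def HasBSProp (𝕂 : Type*) [RCLike 𝕂] {X Y : Type*} [NormedAddCommGroup X] [NormedSpace 𝕂 X]
    [NormedAddCommGroup Y] [NormedSpace 𝕂 Y] (T : X →L[𝕂] Y) : Prop :=
  ∀ S : X →L[𝕂] Y, BJOrth 𝕂 T S →
    ∃ x : X, ‖x‖ = 1 ∧ ‖T x‖ = ‖T‖ ∧ BJOrth 𝕂 (T x) (S x)

/-- `Y` is (complex) strictly convex: for `x ∈ S_Y`, if the maximum of `‖x + θ • y‖` over the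
unit sphere of scalars `θ` equals `1`, then `y = 0`. -/
def ComplexStrictlyConvex (𝕂 : Type*) [RCLike 𝕂] (Y : Type*) [NormedAddCommGroup Y]
    [NormedSpace 𝕂 Y] : Prop :=
  ∀ x y : Y, ‖x‖ = 1 →
    IsGreatest {r : ℝ | ∃ θ : 𝕂, ‖θ‖ = 1 ∧ r = ‖x + θ • y‖} 1 → y = 0

open scoped ZeroAtInfty

/-- A point of the unit sphere of a (complex) strictly convex space is not the centre of a
nontrivial disc in the unit ball. -/
lemma ComplexStrictlyConvex.eq_zero_of_forall_norm_le {𝕂 Y : Type*} [RCLike 𝕂]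
    [NormedAddCommGroup Y] [NormedSpace 𝕂 Y] (hY : ComplexStrictlyConvex 𝕂 Y) {x y : Y} {r : ℝ}
    (hr : 0 < r) (hx : ‖x‖ = r) (h : ∀ θ : 𝕂, ‖θ‖ = 1 → ‖x + θ • y‖ ≤ r) : y = 0 := by
  have hrK : (r : 𝕂) ≠ 0 := by exact_mod_cast hr.ne'
  have scaled (z : Y) : ‖(r : 𝕂)⁻¹ • z‖ = r⁻¹ * ‖z‖ := by
    rw [norm_smul, norm_inv, RCLike.norm_ofReal, abs_of_pos hr]
  have hadd (θ : 𝕂) : ‖(r : 𝕂)⁻¹ • x + θ • (r : 𝕂)⁻¹ • y‖ = r⁻¹ * ‖x + θ • y‖ := by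
    rw [smul_comm θ, ← smul_add, scaled]
  have key := hY ((r : 𝕂)⁻¹ • x) ((r : 𝕂)⁻¹ • y)
    (by rw [scaled, hx, inv_mul_cancel₀ hr.ne']) ⟨⟨1, by simp, ?_⟩, ?_⟩
  · simpa [hrK] using key
  · have h₁ := h 1 (by simp)
    have h₂ := h (-1) (by simp)
    have h₃ : ‖(2 : 𝕂) • x‖ = 2 * r := by simp [norm_smul, hx]
    have h₄ : (2 : 𝕂) • x = (x + (1 : 𝕂) • y) + (x + (-1 : 𝕂) • y) := by module
    have h₅ := norm_add_le (x + (1 : 𝕂) • y) (x + (-1 : 𝕂) • y)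
    rw [← h₄, h₃] at h₅
    rw [hadd, le_antisymm h₁ (by linarith), inv_mul_cancel₀ hr.ne']
  · rintro _ ⟨θ, hθ, rfl⟩
    rw [hadd, inv_mul_le_iff₀ hr, mul_one]
    exact h θ hθ

namespace ZeroAtInftyContinuousMap

variable {𝕂 : Type*} [RCLike 𝕂]

lemma norm_apply_le_norm (x : C₀(ℕ, 𝕂)) (n : ℕ) : ‖x n‖ ≤ ‖x‖ :=
  x.toBCF.norm_coe_le_norm n

lemma norm_le_of_forall_norm_apply_le {x : C₀(ℕ, 𝕂)} {r : ℝ} (hr : 0 ≤ r)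
    (h : ∀ n, ‖x n‖ ≤ r) : ‖x‖ ≤ r :=
  (BoundedContinuousFunction.norm_le hr).2 h

lemma tendsto_atTop (x : C₀(ℕ, 𝕂)) : Filter.Tendsto x Filter.atTop (nhds 0) := by
  simpa [Filter.cocompact_eq_cofinite, Nat.cofinite_eq_atTop] using x.zero_at_infty'

variable (𝕂) in
/-- The standard unit vectors of `c₀`. -/
def unitVector (n : ℕ) : C₀(ℕ, 𝕂) where
  toFun := Pi.single n 1
  continuous_toFun := continuous_of_discreteTopology
  zero_at_infty' := by
    rw [Filter.cocompact_eq_cofinite, Nat.cofinite_eq_atTop]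
    refine tendsto_const_nhds.congr' ?_
    filter_upwards [Filter.eventually_gt_atTop n] with m hm
    simp [hm.ne']

lemma unitVector_apply (n m : ℕ) : unitVector 𝕂 n m = if m = n then 1 else 0 :=
  Pi.single_apply n (1 : 𝕂) m

lemma norm_unitVector_zero : ‖unitVector 𝕂 0‖ = 1 := by
  refine le_antisymm (norm_le_of_forall_norm_apply_le zero_le_one fun n ↦ ?_) ?_
  · rw [unitVector_apply]
    split_ifs <;> simp
  · simpa [unitVector_apply] using norm_apply_le_norm (unitVector 𝕂 0) 0

lemma norm_geometric_smul_apply_le (N : ℕ) (x : C₀(ℕ, 𝕂)) (n : ℕ) :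
    ‖(2 : 𝕂)⁻¹ / 2 ^ n * x (n + N)‖ ≤ ‖x‖ / 2 / 2 ^ n := by
  have := norm_apply_le_norm x (n + N)
  rw [norm_mul, norm_div, norm_inv, norm_pow, RCLike.norm_two]
  calc (2 : ℝ)⁻¹ / 2 ^ n * ‖x (n + N)‖ ≤ 2⁻¹ / 2 ^ n * ‖x‖ := by gcongr
    _ = ‖x‖ / 2 / 2 ^ n := by ring

lemma summable_geometric_smul_apply (N : ℕ) (x : C₀(ℕ, 𝕂)) :
    Summable fun n ↦ (2 : 𝕂)⁻¹ / 2 ^ n * x (n + N) :=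
  .of_norm_bounded (summable_geometric_two' ‖x‖) (norm_geometric_smul_apply_le N x)

variable (𝕂) in
/-- The norm-one functional `x ↦ ∑ 2⁻ⁿ⁻¹ x (n + N)` on `c₀`, which does not attain its norm. -/
def geometricFunctional (N : ℕ) : C₀(ℕ, 𝕂) →L[𝕂] 𝕂 :=
  LinearMap.mkContinuous
    { toFun := fun x ↦ ∑' n, (2 : 𝕂)⁻¹ / 2 ^ n * x (n + N)
      map_add' := fun x y ↦ by
        rw [← (summable_geometric_smul_apply N x).tsum_add (summable_geometric_smul_apply N y)]
        simp [mul_add]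
      map_smul' := fun a x ↦ by
        simp [← tsum_mul_left, mul_left_comm] } 1 fun x ↦ by
    rw [one_mul]
    exact tsum_of_norm_bounded (hasSum_geometric_two' ‖x‖) (norm_geometric_smul_apply_le N x)

lemma geometricFunctional_apply (N : ℕ) (x : C₀(ℕ, 𝕂)) :
    geometricFunctional 𝕂 N x = ∑' n, (2 : 𝕂)⁻¹ / 2 ^ n * x (n + N) := rfl

lemma norm_geometricFunctional_lt (N : ℕ) {x : C₀(ℕ, 𝕂)} (hx : ‖x‖ = 1) :
    ‖geometricFunctional 𝕂 N x‖ < 1 := by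
  have hle := norm_geometric_smul_apply_le N x
  rw [hx] at hle
  have hs : Summable fun n ↦ ‖(2 : 𝕂)⁻¹ / 2 ^ n * x (n + N)‖ :=
    .of_nonneg_of_le (fun _ ↦ norm_nonneg _) hle (summable_geometric_two' 1)
  have hlim := x.tendsto_atTop.norm.comp (Filter.tendsto_add_atTop_nat N)
  obtain ⟨n, hn⟩ := (hlim.eventually_lt_const (by simp : ‖(0 : 𝕂)‖ < 1)).exists
  rw [Function.comp_apply] at hn
  rw [geometricFunctional_apply]
  refine (norm_tsum_le_tsum_norm hs).trans_lt ?_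
  rw [← tsum_geometric_two' 1]
  refine hs.tsum_lt_tsum hle (i := n) ?_ (summable_geometric_two' 1)
  rw [norm_mul, norm_div, norm_inv, norm_pow, RCLike.norm_two]
  calc (2 : ℝ)⁻¹ / 2 ^ n * ‖x (n + N)‖ < 2⁻¹ / 2 ^ n * 1 := by gcongr
    _ = 1 / 2 / 2 ^ n := by ring

/-- The sequence `x` with the `M` coordinates from `N` on replaced by `1`. -/
def replaceByOne (x : C₀(ℕ, 𝕂)) (N M : ℕ) : C₀(ℕ, 𝕂) :=
  x + ∑ i ∈ Finset.range M, (1 - x (i + N)) • unitVector 𝕂 (i + N)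

lemma replaceByOne_succ (x : C₀(ℕ, 𝕂)) (N M : ℕ) :
    x.replaceByOne N (M + 1) =
      x.replaceByOne N M + (1 - x (M + N)) • unitVector 𝕂 (M + N) := by
  rw [replaceByOne, replaceByOne, Finset.sum_range_succ, add_assoc]

lemma replaceByOne_apply (x : C₀(ℕ, 𝕂)) (N M n : ℕ) :
    x.replaceByOne N M n = if N ≤ n ∧ n < M + N then 1 else x n := by
  induction M with
  | zero =>
    rw [if_neg (by omega)]
    simp [replaceByOne]
  | succ M ih =>
    rw [replaceByOne_succ, add_apply, ih, smul_apply, unitVector_apply]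
    by_cases hn : n = M + N
    · subst hn
      simp
    · have : (N ≤ n ∧ n < M + 1 + N) ↔ (N ≤ n ∧ n < M + N) := by omega
      simp [hn, this]

lemma norm_replaceByOne_le {x : C₀(ℕ, 𝕂)} (hx : ‖x‖ = 1) (N M : ℕ) :
    ‖x.replaceByOne N M‖ ≤ 1 := by
  refine norm_le_of_forall_norm_apply_le zero_le_one fun n ↦ ?_
  rw [replaceByOne_apply]
  split_ifs
  · simp
  · exact hx ▸ norm_apply_le_norm x n

lemma tendsto_geometricFunctional_replaceByOne (x : C₀(ℕ, 𝕂)) (hx : ‖x‖ = 1) (N : ℕ) :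
    Filter.Tendsto (fun M ↦ geometricFunctional 𝕂 N (x.replaceByOne N M)) Filter.atTop
      (nhds 1) := by
  have hone : ∑' n : ℕ, (2 : 𝕂)⁻¹ / 2 ^ n * 1 = 1 := by
    have := congrArg (RCLike.ofReal : ℝ → 𝕂) (tsum_geometric_two' 1)
    rw [RCLike.ofReal_tsum] at this
    simpa only [mul_one, one_div, RCLike.ofReal_div, RCLike.ofReal_inv, RCLike.ofReal_pow,
      RCLike.ofReal_ofNat, RCLike.ofReal_one] using this
  rw [← hone]
  simp only [geometricFunctional_apply]
  refine tendsto_tsum_of_dominated_convergence (summable_geometric_two' 1) (fun n ↦ ?_)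
    (.of_forall fun M n ↦ (norm_geometric_smul_apply_le N _ n).trans ?_)
  · refine tendsto_const_nhds.congr' ?_
    filter_upwards [Filter.eventually_gt_atTop n] with M hM
    rw [replaceByOne_apply, if_pos (by omega)]
  · gcongr
    exact norm_replaceByOne_le hx N M

lemma map_replaceByOne {Y : Type*} [NormedAddCommGroup Y] [NormedSpace 𝕂 Y]
    {T : C₀(ℕ, 𝕂) →L[𝕂] Y} {N : ℕ} (hT : ∀ n, N ≤ n → T (unitVector 𝕂 n) = 0)
    (x : C₀(ℕ, 𝕂)) (M : ℕ) : T (x.replaceByOne N M) = T x := by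
  simp [replaceByOne, hT]

end ZeroAtInftyContinuousMap

open ZeroAtInftyContinuousMap

lemma opNorm_pos_of_ne_zero {𝕂 X Y : Type*} [RCLike 𝕂] [SeminormedAddCommGroup X]
    [NormedSpace 𝕂 X] [NormedAddCommGroup Y] [NormedSpace 𝕂 Y] {T : X →L[𝕂] Y} (hT : T ≠ 0) :
    0 < ‖T‖ :=
  T.opNorm_nonneg.lt_of_ne' fun h ↦ hT <| by
    ext z
    simpa [h] using T.le_opNorm z

/-- A norm-attaining operator from `c₀` into a (complex) strictly convex space vanishes on all
but finitely many unit vectors. -/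
lemma ComplexStrictlyConvex.exists_forall_map_unitVector_eq_zero {𝕂 Y : Type*} [RCLike 𝕂]
    [NormedAddCommGroup Y] [NormedSpace 𝕂 Y] (hY : ComplexStrictlyConvex 𝕂 Y)
    {T : C₀(ℕ, 𝕂) →L[𝕂] Y} (hT : T ≠ 0) {x : C₀(ℕ, 𝕂)} (hx : ‖x‖ = 1) (hTx : ‖T x‖ = ‖T‖) :
    ∃ N, ∀ n, N ≤ n → T (unitVector 𝕂 n) = 0 := by
  obtain ⟨N, hN⟩ := Filter.eventually_atTop.1
    (x.tendsto_atTop.norm.eventually_lt_const (by simp : ‖(0 : 𝕂)‖ < 1 / 2))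
  refine ⟨N, fun n hn ↦ ?_⟩
  have hpos := opNorm_pos_of_ne_zero hT
  have key : (2 : 𝕂)⁻¹ • T (unitVector 𝕂 n) = 0 := by
    refine hY.eq_zero_of_forall_norm_le hpos hTx fun θ hθ ↦ ?_
    rw [← map_smul, ← map_smul, ← map_add]
    refine T.unit_le_opNorm _ (norm_le_of_forall_norm_apply_le zero_le_one fun m ↦ ?_)
    rw [ZeroAtInftyContinuousMap.add_apply, ZeroAtInftyContinuousMap.smul_apply,
      ZeroAtInftyContinuousMap.smul_apply, unitVector_apply]
    split_ifs with hm
    · subst hm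
      refine (norm_add_le _ _).trans ?_
      have := hN m hn
      simp only [smul_eq_mul, mul_one, norm_mul, hθ, norm_inv, RCLike.norm_two]
      linarith
    · simpa [hx] using norm_apply_le_norm x m
  simpa using key

/-- A norm-attaining operator on `c₀` which vanishes on all but finitely many unit vectors fails
the Bhatia--Šemrl property. -/
lemma not_hasBSProp_of_map_unitVector_eq_zero {𝕂 Y : Type*} [RCLike 𝕂]
    [NormedAddCommGroup Y] [NormedSpace 𝕂 Y] {T : C₀(ℕ, 𝕂) →L[𝕂] Y} (hT : T ≠ 0)
    {x : C₀(ℕ, 𝕂)} (hx : ‖x‖ = 1) (hTx : ‖T x‖ = ‖T‖) {N : ℕ}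
    (hN : ∀ n, N ≤ n → T (unitVector 𝕂 n) = 0) : ¬ HasBSProp 𝕂 T := by
  intro h
  set S : C₀(ℕ, 𝕂) →L[𝕂] Y := (geometricFunctional 𝕂 N).smulRight (T x) - T with hS
  have hSz (z : C₀(ℕ, 𝕂)) : S z = geometricFunctional 𝕂 N z • T x - T z := by simp [hS]
  obtain ⟨z, hz, hTz, hz'⟩ := h S fun a ↦ by
    have hlim : Filter.Tendsto (fun M ↦ ‖(T + a • S) (x.replaceByOne N M)‖) Filter.atTop
        (nhds ‖T x + a • ((1 : 𝕂) • T x - T x)‖) := by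
      simp only [_root_.add_apply, _root_.smul_apply, hSz,
        map_replaceByOne hN]
      exact (((((tendsto_geometricFunctional_replaceByOne x hx N).smul_const (T x)).sub_const
        (T x)).const_smul a).const_add (T x)).norm
    rw [one_smul, sub_self, smul_zero, add_zero, hTx] at hlim
    exact le_of_tendsto hlim (.of_forall fun M ↦
      (T + a • S).unit_le_opNorm _ (norm_replaceByOne_le hx N M))
  have hpos := opNorm_pos_of_ne_zero hT
  have hle := hz' 1
  rw [one_smul, hSz, add_sub_cancel, norm_smul, hTz, hTx] at hle
  nlinarith [norm_geometricFunctional_lt N hz]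

open scoped ZeroAtInfty in
/-- If `Y` is (complex) strictly convex, then the zero operator is the only operator from
`c₀` to `Y` with the Bhatia--Šemrl property. -/
theorem BS_eq_zero_of_complexStrictlyConvex {𝕂 Y : Type*} [RCLike 𝕂]
    [NormedAddCommGroup Y] [NormedSpace 𝕂 Y] [CompleteSpace Y]
    (hY : ComplexStrictlyConvex 𝕂 Y) :
    {T : C₀(ℕ, 𝕂) →L[𝕂] Y | HasBSProp 𝕂 T} = {0} := by
  ext T
  simp only [Set.mem_ofPred_eq, Set.mem_singleton_iff]
  constructor
  · intro h
    by_contra hT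
    obtain ⟨x, hx, hTx, -⟩ := h 0 fun a ↦ by simp
    obtain ⟨N, hN⟩ := hY.exists_forall_map_unitVector_eq_zero hT hx hTx
    exact not_hasBSProp_of_map_unitVector_eq_zero hT hx hTx hN h
  · rintro rfl S -
    exact ⟨unitVector 𝕂 0, norm_unitVector_zero, by simp, fun a ↦ by simp⟩
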